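/- For any finite point set P in ℝ^d, the edge-squared metric and the nearest-neighbor geodesic distance are identical: for all a, b ∈ P, d₂(a,b) = d_N(a,b). -/

import Mathlib

open scoped BigOperators
open MeasureTheory

noncomputable section

/-- Points of `ℝ^d`. -/
abbrev Pt (d : ℕ) : Type := EuclideanSpace ℝ (Fin d)

/-- The edge-squared metric on a point set `P ⊆ ℝ^d`: the infimum over finite chains of points
of `P` from `a` to `b` of the sum of squared Euclidean lengths of the steps. -/
noncomputable def edgeSq {d : ℕ} (P : Set (Pt d)) (a b : Pt d) : ℝ :=
  sInf {c : ℝ | ∃ (k : ℕ) (p : Fin (k + 1) → Pt d), p 0 = a ∧ p (Fin.last k) = b ∧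
    (∀ i, p i ∈ P) ∧ c = ∑ i : Fin k, ‖p i.succ - p i.castSucc‖ ^ 2}

/-- A path `γ : [0,1] → ℝ^d` is piecewise-C¹ if it is continuous on `[0,1]` and there is a
partition `0 = t₀ < t₁ < ⋯ < t_m = 1` such that `γ` is `C¹` on each subinterval. -/
def PiecewiseC1 {d : ℕ} (γ : ℝ → Pt d) : Prop :=
  ContinuousOn γ (Set.Icc 0 1) ∧
  ∃ (m : ℕ) (t : Fin (m + 1) → ℝ), StrictMono t ∧ t 0 = 0 ∧ t (Fin.last m) = 1 ∧
    ∀ i : Fin m, ContDiffOn ℝ 1 γ (Set.Icc (t i.castSucc) (t i.succ))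

/-- The nearest-neighbor length of a path: `ℓ(γ) = ∫₀¹ r_P(γ(t)) ‖γ'(t)‖ dt`, where
`r_P(z) = min_{x ∈ P} ‖x - z‖` is the distance to the nearest point of `P`. -/
noncomputable def nnLength {d : ℕ} (P : Set (Pt d)) (γ : ℝ → Pt d) : ℝ :=
  ∫ t in (0:ℝ)..1, Metric.infDist (γ t) P * ‖deriv γ t‖

/-- The nearest-neighbor geodesic distance:
`d_N(a,b) = 4 ⬝ inf { ℓ(γ) | γ piecewise-C¹ path from a to b }`. -/
noncomputable def nnGeo {d : ℕ} (P : Set (Pt d)) (a b : Pt d) : ℝ :=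
  4 * sInf {l : ℝ | ∃ γ : ℝ → Pt d, PiecewiseC1 γ ∧ γ 0 = a ∧ γ 1 = b ∧ l = nnLength P γ}


lemma var_identity {ι F : Type*} [Fintype ι] [NormedAddCommGroup F] [InnerProductSpace ℝ F]
    (w : ι → ℝ) (hw : ∑ i, w i = 1) (y : ι → F) :
    ∑ i, ∑ j, w i * w j * ‖y i - y j‖ ^ 2
      = 2 * (∑ i, w i * ‖y i‖ ^ 2 - ‖∑ i, w i • y i‖ ^ 2) := by
  have h1 : ‖∑ i, w i • y i‖ ^ 2 = ∑ i, ∑ j, w i * w j * inner ℝ (y i) (y j) := by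
    rw [← real_inner_self_eq_norm_sq, sum_inner]
    refine Finset.sum_congr rfl fun i _ => ?_
    rw [inner_sum]
    refine Finset.sum_congr rfl fun j _ => ?_
    rw [real_inner_smul_left, real_inner_smul_right]; ring
  have h2 : ∑ i, ∑ j, w i * w j * ‖y i‖ ^ 2 = ∑ i, w i * ‖y i‖ ^ 2 := by
    refine Finset.sum_congr rfl fun i _ => ?_
    rw [← Finset.sum_mul, ← Finset.mul_sum, hw, mul_one]
  have h3 : ∑ i, ∑ j, w i * w j * ‖y j‖ ^ 2 = ∑ i, w i * ‖y i‖ ^ 2 := by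
    rw [Finset.sum_comm]
    refine Finset.sum_congr rfl fun i _ => ?_
    rw [← Finset.sum_mul, ← Finset.sum_mul, hw, one_mul]
  have h4 : ∑ i, ∑ j, w i * w j * ‖y i - y j‖ ^ 2
      = ∑ i, ∑ j, w i * w j * ‖y i‖ ^ 2 + ∑ i, ∑ j, w i * w j * ‖y j‖ ^ 2
        - 2 * ∑ i, ∑ j, w i * w j * inner ℝ (y i) (y j) := by
    simp only [Finset.mul_sum, ← Finset.sum_add_distrib, ← Finset.sum_sub_distrib]
    refine Finset.sum_congr rfl fun i _ => Finset.sum_congr rfl fun j _ => ?_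
    rw [norm_sub_sq_real]; ring
  rw [h4, h2, h3, h1]; ring

lemma kirszbraun_one {ι E F : Type*} [Fintype ι] [NormedAddCommGroup E] [InnerProductSpace ℝ E]
    [NormedAddCommGroup F] [InnerProductSpace ℝ F] (x : ι → E) (y : ι → F)
    (h : ∀ i j, ‖y i - y j‖ ≤ ‖x i - x j‖) (x0 : E) :
    ∃ y0 : F, ∀ i, ‖y0 - y i‖ ≤ ‖x0 - x i‖ := by
  classical
  rcases isEmpty_or_nonempty ι with he | hne
  · exact ⟨0, fun i => he.elim i⟩
  let g : (ι → ℝ) → ℝ := fun w => ∑ i, w i * (‖y i‖ ^ 2 - ‖x i - x0‖ ^ 2) - ‖∑ i, w i • y i‖ ^ 2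
  have hg : Continuous g := by fun_prop
  have hne' : (stdSimplex ℝ ι).Nonempty := ⟨_, single_mem_stdSimplex ℝ (Classical.arbitrary ι)⟩
  obtain ⟨w, hwS, hmax⟩ := (isCompact_stdSimplex ℝ ι).exists_isMaxOn hne' hg.continuousOn
  obtain ⟨hw0, hw1⟩ := hwS
  have hgw : g w ≤ 0 := by
    have e1 := var_identity w hw1 y
    have e2 := var_identity w hw1 (fun i => x i - x0)
    have hle : ∑ i, ∑ j, w i * w j * ‖y i - y j‖ ^ 2
        ≤ ∑ i, ∑ j, w i * w j * ‖(x i - x0) - (x j - x0)‖ ^ 2 := by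
      refine Finset.sum_le_sum fun i _ => Finset.sum_le_sum fun j _ => ?_
      have := h i j
      rw [sub_sub_sub_cancel_right]
      have := mul_nonneg (hw0 i) (hw0 j)
      gcongr
    have e3 : g w = (∑ i, w i * ‖y i‖ ^ 2 - ‖∑ i, w i • y i‖ ^ 2)
        - ∑ i, w i * ‖x i - x0‖ ^ 2 := by
      simp only [g, mul_sub, Finset.sum_sub_distrib]; ring
    have := sq_nonneg ‖∑ i, w i • (x i - x0)‖
    rw [e3]; linarith
  set Y := ∑ i, w i • y i with hY
  set A := ∑ i, w i * (‖y i‖ ^ 2 - ‖x i - x0‖ ^ 2) with hA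
  have hgw' : g w = A - ‖Y‖ ^ 2 := rfl
  refine ⟨Y, fun j => ?_⟩
  set D := ‖y j - Y‖ ^ 2 with hD
  have hD0 : 0 ≤ D := sq_nonneg _
  set c := (‖y j‖ ^ 2 - ‖x j - x0‖ ^ 2) - A - 2 * inner ℝ Y (y j - Y) with hc
  have key : ∀ t : ℝ, 0 < t → t ≤ 1 → c ≤ t * D := by
    intro t ht ht1
    have hmem : (1 - t) • w + t • (Pi.single j 1 : ι → ℝ) ∈ stdSimplex ℝ ι :=
      convex_stdSimplex ℝ ι ⟨hw0, hw1⟩ (single_mem_stdSimplex ℝ j) (by linarith) ht.le (by ring)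
    have hm : g ((1 - t) • w + t • (Pi.single j 1 : ι → ℝ)) ≤ g w := hmax hmem
    have e1 : ∑ i, ((1 - t) • w + t • (Pi.single j 1 : ι → ℝ)) i • y i = Y + t • (y j - Y) := by
      simp only [Pi.add_apply, Pi.smul_apply, add_smul, Finset.sum_add_distrib, smul_eq_mul,
        mul_smul, ← Finset.smul_sum, ← hY]
      rw [Finset.sum_eq_single j (by intro b _ hb; simp [Pi.single_eq_of_ne hb]) (by simp)]
      simp only [Pi.single_eq_same, one_smul]
      module
    have e2 : ∑ i, ((1 - t) • w + t • (Pi.single j 1 : ι → ℝ)) i * (‖y i‖ ^ 2 - ‖x i - x0‖ ^ 2)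
        = (1 - t) * A + t * (‖y j‖ ^ 2 - ‖x j - x0‖ ^ 2) := by
      simp only [Pi.add_apply, Pi.smul_apply, add_mul, Finset.sum_add_distrib, smul_eq_mul,
        mul_assoc, ← Finset.mul_sum, ← hA]
      rw [Finset.sum_eq_single j (by intro b _ hb; simp [Pi.single_eq_of_ne hb]) (by simp)]
      simp
    rw [hgw'] at hm
    simp only [g] at hm
    rw [e1, e2, norm_add_sq_real, norm_smul, real_inner_smul_right, mul_pow, ← hD,
      Real.norm_eq_abs, sq_abs] at hm
    have : t * (c - t * D) ≤ 0 := by rw [hc]; nlinarith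
    by_contra hcon
    push Not at hcon
    have := mul_pos ht (sub_pos.2 hcon)
    linarith
  have hc0 : c ≤ 0 := by
    by_contra hcon
    push Not at hcon
    have hs : 0 < c + D := by linarith
    have := key (c / (c + D)) (by positivity) (by rw [div_le_one hs]; linarith)
    rw [div_mul_eq_mul_div, le_div_iff₀ hs] at this
    nlinarith
  have hfin : ‖Y - y j‖ ^ 2 ≤ ‖x0 - x j‖ ^ 2 := by
    rw [norm_sub_rev x0, norm_sub_sq_real]
    rw [inner_sub_right, real_inner_self_eq_norm_sq] at hc
    linarith
  exact le_of_sq_le_sq hfin (norm_nonneg _)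

lemma kirszbraun_finset {E F : Type*} [NormedAddCommGroup E] [InnerProductSpace ℝ E]
    [NormedAddCommGroup F] [InnerProductSpace ℝ F] (P : Finset E) (q : E → F)
    (h : ∀ x ∈ P, ∀ y ∈ P, ‖q x - q y‖ ≤ ‖x - y‖) (S : Finset E) :
    ∃ f : E → F, (∀ x ∈ P, f x = q x) ∧
      ∀ x, x ∈ P ∨ x ∈ S → ∀ y, y ∈ P ∨ y ∈ S → ‖f x - f y‖ ≤ ‖x - y‖ := by
  classical
  induction S using Finset.induction_on with
  | empty => exact ⟨q, fun _ _ => rfl, by simpa using h⟩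
  | insert z S hz ih =>
    obtain ⟨f, hf, hl⟩ := ih
    by_cases hzP : z ∈ P
    · refine ⟨f, hf, fun x hx y hy => hl x ?_ y ?_⟩
      · rcases hx with hx | hx
        · exact Or.inl hx
        · rcases Finset.mem_insert.1 hx with rfl | hx
          · exact Or.inl hzP
          · exact Or.inr hx
      · rcases hy with hx | hx
        · exact Or.inl hx
        · rcases Finset.mem_insert.1 hx with rfl | hx
          · exact Or.inl hzP
          · exact Or.inr hx
    · obtain ⟨y0, hy0⟩ := kirszbraun_one (ι := {x // x ∈ P ∪ S}) (fun i => (i : E))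
        (fun i => f i) (fun i j => hl i (Finset.mem_union.1 i.2) j (Finset.mem_union.1 j.2)) z
      have hy1 : ∀ x, x ∈ P ∨ x ∈ S → ‖y0 - f x‖ ≤ ‖z - x‖ := fun x hx =>
        hy0 ⟨x, Finset.mem_union.2 hx⟩
      have hcase : ∀ x, (x ∈ P ∨ x ∈ insert z S) → x = z ∨ (x ≠ z ∧ (x ∈ P ∨ x ∈ S)) := by
        intro x hx
        by_cases hxz : x = z
        · exact Or.inl hxz
        · simp only [Finset.mem_insert, hxz, false_or] at hx
          exact Or.inr ⟨hxz, hx⟩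
      refine ⟨Function.update f z y0, fun x hx => ?_, fun x hx y hy => ?_⟩
      · rw [Function.update_of_ne (by rintro rfl; exact hzP hx), hf x hx]
      · rcases hcase x hx with rfl | ⟨hxz, hx⟩ <;> rcases hcase y hy with rfl | ⟨hyz, hy⟩
        · simp
        · rw [Function.update_self, Function.update_of_ne hyz]; exact hy1 y hy
        · rw [Function.update_self, Function.update_of_ne hxz, norm_sub_rev, norm_sub_rev x]
          exact hy1 x (by assumption)
        · rw [Function.update_of_ne hyz, Function.update_of_ne hxz]; exact hl x hx y hy

lemma kirszbraun {E F : Type*} [NormedAddCommGroup E] [InnerProductSpace ℝ E]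
    [NormedAddCommGroup F] [InnerProductSpace ℝ F] [ProperSpace F] (P : Finset E) (q : E → F)
    (a : E) (ha : a ∈ P)
    (h : ∀ x ∈ P, ∀ y ∈ P, ‖q x - q y‖ ≤ ‖x - y‖) :
    ∃ f : E → F, (∀ x ∈ P, f x = q x) ∧ ∀ x y, ‖f x - f y‖ ≤ ‖x - y‖ := by
  classical
  let B : Set (E → F) := Set.univ.pi fun z => Metric.closedBall (q a) ‖z - a‖
  have hB : IsCompact B := isCompact_univ_pi fun z => isCompact_closedBall _ _
  let C : Finset E → Set (E → F) := fun S =>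
    {f | (∀ x ∈ P, f x = q x) ∧ ∀ x ∈ S, ∀ y ∈ S, ‖f x - f y‖ ≤ ‖x - y‖}
  have hC : ∀ S, IsClosed (C S) := by
    intro S
    simp only [C, Set.ofPred_and, Set.ofPred_forall]
    refine IsClosed.inter ?_ ?_
    · exact isClosed_biInter fun x _ => isClosed_eq (by fun_prop) (by fun_prop)
    · exact isClosed_biInter fun x _ => isClosed_biInter fun y _ =>
        isClosed_le (by fun_prop) (by fun_prop)
  have hne : (⋂ S, B ∩ C S).Nonempty := by
    refine IsCompact.nonempty_iInter_of_directed_nonempty_isCompact_isClosed _ ?_ ?_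
      (fun S => hB.inter_right (hC S)) (fun S => hB.isClosed.inter (hC S))
    · intro S T
      refine ⟨S ∪ T, ?_, ?_⟩
      · rintro f ⟨h1, h2, h3⟩
        exact ⟨h1, h2, fun x hx y hy => h3 x (Finset.mem_union_left _ hx) y
          (Finset.mem_union_left _ hy)⟩
      · rintro f ⟨h1, h2, h3⟩
        exact ⟨h1, h2, fun x hx y hy => h3 x (Finset.mem_union_right _ hx) y
          (Finset.mem_union_right _ hy)⟩
    · intro S
      obtain ⟨f, hf, hl⟩ := kirszbraun_finset P q h S
      refine ⟨fun z => if z ∈ P ∨ z ∈ S then f z else q a, ?_, ?_, ?_⟩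
      · intro z _
        simp only [Metric.mem_closedBall, dist_eq_norm]
        split_ifs with hz
        · rw [← hf a ha]; exact hl z hz a (Or.inl ha)
        · simp
      · intro x hx
        simp [hx, hf x hx]
      · intro x hx y hy
        simp only [hx, hy, or_true, if_true]
        exact hl x (Or.inr hx) y (Or.inr hy)
  obtain ⟨f, hf⟩ := hne
  rw [Set.mem_iInter] at hf
  exact ⟨f, (hf ∅).2.1, fun x y => (hf {x, y}).2.2 x (by simp) y (by simp)⟩

lemma exists_sorted (V : Finset ℝ) : ∃ u : ℕ → ℝ, Monotone u ∧ ∀ v ∈ V, ∃ k, u k = v := by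
  classical
  rcases V.eq_empty_or_nonempty with rfl | hV
  · exact ⟨fun _ => 0, monotone_const, by simp⟩
  have hc : 0 < V.card := hV.card_pos
  refine ⟨fun k => V.orderEmbOfFin rfl ⟨min k (V.card - 1), by omega⟩, ?_, ?_⟩
  · intro i j hij
    apply (V.orderEmbOfFin rfl).monotone
    simp only [Fin.mk_le_mk]
    omega
  · intro v hv
    have : v ∈ Set.range (V.orderEmbOfFin rfl) := by simpa using hv
    obtain ⟨k, hk⟩ := this
    refine ⟨k, ?_⟩
    rw [← hk]
    have := k.2
    change V.orderEmbOfFin rfl _ = V.orderEmbOfFin rfl _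
    congr 1
    apply Fin.ext
    change min (k : ℕ) (V.card - 1) = k
    omega

/-- The one-dimensional potential on an edge of length `s`. -/
noncomputable def Gpot (s x : ℝ) : ℝ := x ^ 2 / 2 - (max 0 (x - s / 2)) ^ 2

lemma Gpot_zero (s : ℝ) (hs : 0 ≤ s) : Gpot s 0 = 0 := by
  unfold Gpot
  rw [max_eq_left (by linarith)]; ring

lemma Gpot_self (s : ℝ) (hs : 0 ≤ s) : Gpot s s = s ^ 2 / 4 := by
  unfold Gpot
  rw [max_eq_right (by linarith)]; ring

lemma Gpot_lip (s x y : ℝ) (hs : 0 ≤ s) :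
    |Gpot s x - Gpot s y| ≤ (min |x| |x - s| + |x - y|) * |x - y| := by
  set m := min |x| |x - s| with hm
  have hmx : |x - 2 * max 0 (x - s / 2)| ≤ m := by
    rw [hm, le_min_iff]
    rcases le_total (x - s / 2) 0 with h | h
    · rw [max_eq_left h]
      constructor
      · simp
      · rw [abs_sub_comm x s, abs_of_nonneg (show 0 ≤ s - x by linarith), abs_le]
        constructor <;> linarith
    · rw [max_eq_right h]
      have hx : 0 ≤ x := by linarith
      constructor
      · rw [abs_of_nonneg hx, abs_le]
        constructor <;> linarith
      · rw [← abs_neg]; apply le_of_eq; ring_nf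
  have key : |Gpot s x - Gpot s y - (x - 2 * max 0 (x - s / 2)) * (x - y)| ≤ (x - y) ^ 2 := by
    unfold Gpot
    rw [abs_le]
    rcases le_total (x - s / 2) 0 with h | h <;> rcases le_total (y - s / 2) 0 with h' | h'
    · rw [max_eq_left h, max_eq_left h']
      constructor <;> nlinarith [sq_nonneg (x - y)]
    · rw [max_eq_left h, max_eq_right h']
      constructor <;> nlinarith [sq_nonneg (x - y), sq_nonneg (y - s / 2),
        mul_nonneg h' (sub_nonneg.2 h), sq_nonneg (x - s / 2)]
    · rw [max_eq_right h, max_eq_left h']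
      constructor <;> nlinarith [sq_nonneg (x - y), sq_nonneg (y - s / 2),
        mul_nonneg h (sub_nonneg.2 h'), sq_nonneg (x - s / 2)]
    · rw [max_eq_right h, max_eq_right h']
      constructor <;> nlinarith [sq_nonneg (x - y)]
  have h3 : |(x - 2 * max 0 (x - s / 2)) * (x - y)| ≤ m * |x - y| := by
    rw [abs_mul]; gcongr
  have h4 := abs_add_le (Gpot s x - Gpot s y - (x - 2 * max 0 (x - s / 2)) * (x - y))
    ((x - 2 * max 0 (x - s / 2)) * (x - y))
  rw [sub_add_cancel] at h4
  rw [← sq_abs] at key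
  nlinarith

lemma potential {d : ℕ} (P : Set (Pt d)) (hP : P.Finite) (φ : Pt d → ℝ)
    (hφ : ∀ x ∈ P, ∀ y ∈ P, φ x - φ y ≤ ‖x - y‖ ^ 2) (a b : Pt d) (ha : a ∈ P) (hb : b ∈ P) :
    ∃ H : Pt d → ℝ, H b - H a = (φ b - φ a) / 4 ∧
      ∀ z w, |H z - H w| ≤ (Metric.infDist z P + ‖z - w‖) * ‖z - w‖ := by
  classical
  obtain ⟨u, hu, hk⟩ := exists_sorted (hP.toFinset.image φ)
  have hk' : ∀ x : Pt d, ∃ k, x ∈ P → u k = φ x := by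
    intro x
    by_cases hx : x ∈ P
    · obtain ⟨k, hk⟩ := hk (φ x) (Finset.mem_image_of_mem _ (by simpa using hx))
      exact ⟨k, fun _ => hk⟩
    · exact ⟨0, fun h => absurd h hx⟩
  choose K hK using hk'
  let n := hP.toFinset.sup K
  have hn : ∀ x ∈ P, K x ≤ n := fun x hx => Finset.le_sup (f := K) (by simpa using hx)
  let s : ℕ → ℝ := fun i => √(u (i + 1) - u i)
  have hs0 : ∀ i, 0 ≤ s i := fun i => Real.sqrt_nonneg _
  have hs2 : ∀ i, s i ^ 2 = u (i + 1) - u i := fun i =>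
    Real.sq_sqrt (sub_nonneg.2 (hu (Nat.le_succ i)))
  let q : Pt d → EuclideanSpace ℝ (Fin n) := fun x =>
    WithLp.toLp 2 fun i => if (i : ℕ) < K x then s i else 0
  have htel : ∀ k, k ≤ n → ∑ i : Fin n, (if (i : ℕ) < k then s i ^ 2 else 0) = u k - u 0 := by
    intro k hk
    rw [Fin.sum_univ_eq_sum_range (fun i => if i < k then s i ^ 2 else 0) n,
      ← Finset.sum_filter]
    have : (Finset.range n).filter (fun i => i < k) = Finset.range k := by
      ext i; simp; omega
    rw [this, ← Finset.sum_range_sub]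
    exact Finset.sum_congr rfl fun i _ => hs2 i
  have hq' : ∀ x ∈ P, ∀ y ∈ P, K x ≤ K y → ‖q y - q x‖ ≤ ‖y - x‖ := by
    intro x hx y hy hxy
    refine le_of_sq_le_sq ?_ (norm_nonneg _)
    refine le_trans (le_of_eq ?_) (hφ y hy x hx)
    rw [EuclideanSpace.norm_sq_eq, ← hK x hx, ← hK y hy]
    have := htel _ (hn x hx)
    have := htel _ (hn y hy)
    rw [show u (K y) - u (K x) = (u (K y) - u 0) - (u (K x) - u 0) by ring,
      ← htel _ (hn x hx), ← htel _ (hn y hy), ← Finset.sum_sub_distrib]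
    refine Finset.sum_congr rfl fun i _ => ?_
    simp only [q, PiLp.sub_apply, Real.norm_eq_abs, sq_abs]
    by_cases h1 : (i : ℕ) < K x
    · have h2 : (i : ℕ) < K y := by omega
      simp [h1, h2]
    · by_cases h2 : (i : ℕ) < K y <;> simp [h1, h2]
  have hq : ∀ x ∈ P, ∀ y ∈ P, ‖q x - q y‖ ≤ ‖x - y‖ := by
    intro x hx y hy
    rcases le_total (K x) (K y) with h | h
    · rw [norm_sub_rev, norm_sub_rev x]; exact hq' x hx y hy h
    · exact hq' y hy x hx h
  obtain ⟨f, hf, hl⟩ := kirszbraun hP.toFinset q a (by simpa using ha)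
    (fun x hx y hy => hq x (by simpa using hx) y (by simpa using hy))
  have hf : ∀ x ∈ P, f x = q x := fun x hx => hf x (by simpa using hx)
  have hval : ∀ x ∈ P, ∑ i : Fin n, Gpot (s i) (f x i) = (φ x - u 0) / 4 := by
    intro x hx
    rw [hf x hx, ← hK x hx, ← htel _ (hn x hx), Finset.sum_div]
    refine Finset.sum_congr rfl fun i _ => ?_
    simp only [q]
    split_ifs
    · exact Gpot_self _ (hs0 i)
    · rw [Gpot_zero _ (hs0 i)]; simp
  refine ⟨fun z => ∑ i : Fin n, Gpot (s i) (f z i), ?_, ?_⟩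
  · simp only
    rw [hval a ha, hval b hb]; ring
  · intro z w
    let m : EuclideanSpace ℝ (Fin n) := WithLp.toLp 2 fun i => min |f z i| |f z i - s i|
    let δ : EuclideanSpace ℝ (Fin n) := WithLp.toLp 2 fun i => |f z i - f w i|
    have hδ : ‖δ‖ ≤ ‖z - w‖ := by
      refine le_trans (le_of_eq ?_) (hl z w)
      rw [EuclideanSpace.norm_eq, EuclideanSpace.norm_eq]
      simp [δ]
    have hm : ‖m‖ ≤ Metric.infDist z P := by
      refine (Metric.le_infDist ⟨a, ha⟩).2 fun x hx => ?_
      rw [dist_eq_norm]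
      refine le_trans ?_ (hl z x)
      rw [hf x hx, EuclideanSpace.norm_eq, EuclideanSpace.norm_eq]
      refine Real.sqrt_le_sqrt (Finset.sum_le_sum fun i _ => ?_)
      have h0 : 0 ≤ min |f z i| |f z i - s i| := le_min (abs_nonneg _) (abs_nonneg _)
      simp only [m, q, PiLp.sub_apply, Real.norm_eq_abs]
      rw [abs_of_nonneg h0]
      gcongr
      split_ifs
      · exact min_le_right _ _
      · rw [sub_zero]; exact min_le_left _ _
    have h1 : |∑ i : Fin n, Gpot (s i) (f z i) - ∑ i : Fin n, Gpot (s i) (f w i)|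
        ≤ inner ℝ (m + δ) δ := by
      rw [← Finset.sum_sub_distrib]
      refine (Finset.abs_sum_le_sum_abs _ _).trans ?_
      rw [PiLp.inner_apply]
      refine Finset.sum_le_sum fun i _ => ?_
      refine (Gpot_lip _ _ _ (hs0 i)).trans (le_of_eq ?_)
      simp [m, δ, mul_comm]
    refine h1.trans ((real_inner_le_norm _ _).trans ?_)
    have := norm_add_le m δ
    have := Metric.infDist_nonneg (x := z) (s := P)
    gcongr
    linarith

lemma piece_bound {d : ℕ} (P : Set (Pt d)) (H : Pt d → ℝ)
    (hH : ∀ z w, |H z - H w| ≤ (Metric.infDist z P + ‖z - w‖) * ‖z - w‖)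
    (γ : ℝ → Pt d) (s t : ℝ) (hst : s < t) (hγ : ContDiffOn ℝ 1 γ (Set.Icc s t)) :
    IntervalIntegrable (fun τ => Metric.infDist (γ τ) P * ‖deriv γ τ‖) volume s t ∧
    H (γ t) - H (γ s) ≤ ∫ τ in s..t, Metric.infDist (γ τ) P * ‖deriv γ τ‖ := by
  have hcH : Continuous H := by
    rw [continuous_iff_continuousAt]
    intro z
    rw [ContinuousAt, tendsto_iff_dist_tendsto_zero]
    have hlim : Filter.Tendsto (fun w => (Metric.infDist z P + ‖z - w‖) * ‖z - w‖)
        (nhds z) (nhds 0) := by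
      have : Continuous (fun w => (Metric.infDist z P + ‖z - w‖) * ‖z - w‖) := by fun_prop
      have h := this.tendsto z
      simpa using h
    refine squeeze_zero (fun _ => dist_nonneg) (fun w => ?_) hlim
    rw [dist_comm, Real.dist_eq]
    exact hH z w
  have hcγ : ContinuousOn γ (Set.Icc s t) := hγ.continuousOn
  have hu : UniqueDiffOn ℝ (Set.Icc s t) := uniqueDiffOn_Icc hst
  set v := derivWithin γ (Set.Icc s t) with hv
  have hcv : ContinuousOn v (Set.Icc s t) := hγ.continuousOn_derivWithin hu le_rfl
  have hcw : ContinuousOn (fun τ => Metric.infDist (γ τ) P * ‖v τ‖) (Set.Icc s t) :=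
    ((Metric.continuous_infDist_pt P).comp_continuousOn hcγ).mul hcv.norm
  have heq : ∀ τ ∈ Set.Ioo s t, deriv γ τ = v τ := fun τ hτ =>
    (derivWithin_of_mem_nhds (Icc_mem_nhds hτ.1 hτ.2)).symm
  have heq' : Set.EqOn (fun τ => Metric.infDist (γ τ) P * ‖v τ‖)
      (fun τ => Metric.infDist (γ τ) P * ‖deriv γ τ‖) (Set.Ioo s t) := by
    intro τ hτ
    simp only [heq τ hτ]
  have hint : IntervalIntegrable (fun τ => Metric.infDist (γ τ) P * ‖v τ‖) volume s t :=
    hcw.intervalIntegrable_of_Icc hst.le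
  refine ⟨hint.congr_uIoo (by rwa [Set.uIoo_of_le hst.le]), ?_⟩
  rw [← intervalIntegral.integral_congr_Ioo_of_le hst.le heq']
  obtain ⟨W, hWc, hWe⟩ : ∃ W : ℝ → ℝ, Continuous W ∧
      Set.EqOn W (fun τ => Metric.infDist (γ τ) P * ‖v τ‖) (Set.Icc s t) := by
    refine ⟨Set.IccExtend hst.le ((Set.Icc s t).domRestrict
      (fun τ => Metric.infDist (γ τ) P * ‖v τ‖)), ?_, ?_⟩
    · exact (continuousOn_iff_continuous_domRestrict.1 hcw).Icc_extend'
    · intro τ hτ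
      rw [Set.IccExtend_of_mem _ _ hτ]; rfl
  rw [← intervalIntegral.integral_congr (f := W) (by rwa [Set.uIcc_of_le hst.le])]
  have hB : ∀ x, HasDerivAt (fun τ => ∫ y in s..τ, W y) (W x) x := fun x =>
    (hWc.integral_hasStrictDerivAt s x).hasDerivAt
  refine image_le_of_liminf_slope_right_le_deriv_boundary
    (f := fun τ => H (γ τ) - H (γ s)) (B := fun τ => ∫ y in s..τ, W y) (B' := W)
    (a := s) (b := t) ?_ (by simp) ?_ ?_ ?_ (Set.right_mem_Icc.2 hst.le)
  · exact (hcH.comp_continuousOn hcγ).sub continuousOn_const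
  · exact fun x _ => (hB x).continuousAt.continuousWithinAt
  · exact fun x _ => (hB x).hasDerivWithinAt
  · intro x hx r hr
    have hxI : x ∈ Set.Icc s t := ⟨hx.1, hx.2.le⟩
    have hd : HasDerivWithinAt γ (v x) (Set.Icc s t) x :=
      ((hγ.differentiableOn one_ne_zero) x hxI).hasDerivWithinAt
    have hd' : HasDerivWithinAt γ (v x) (Set.Ioi x) x :=
      hd.mono_of_mem_nhdsWithin (Icc_mem_nhdsGT_of_mem hx)
    have hsl := (hasDerivWithinAt_iff_tendsto_slope' (by simp)).1 hd'
    have hγx := hd'.continuousWithinAt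
    have hlim : Filter.Tendsto (fun z => (Metric.infDist (γ x) P + ‖γ x - γ z‖) * ‖slope γ x z‖)
        (nhdsWithin x (Set.Ioi x)) (nhds ((Metric.infDist (γ x) P + ‖γ x - γ x‖) * ‖v x‖)) :=
      (tendsto_const_nhds.add (tendsto_const_nhds.sub hγx).norm).mul hsl.norm
    have hlt : (Metric.infDist (γ x) P + ‖γ x - γ x‖) * ‖v x‖ < r := by
      rw [hWe hxI] at hr
      simpa using hr
    have hev := hlim.eventually (gt_mem_nhds hlt)
    refine Filter.Eventually.frequently ?_
    filter_upwards [hev, self_mem_nhdsWithin] with z hz hzx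
    refine lt_of_le_of_lt ?_ hz
    have hpos : 0 < z - x := sub_pos.2 hzx
    rw [slope_def_field, slope_def_module, norm_smul, div_le_iff₀ hpos, norm_inv,
      Real.norm_of_nonneg hpos.le]
    have h1 := (abs_le.1 (hH (γ x) (γ z))).1
    have h2 : (Metric.infDist (γ x) P + ‖γ x - γ z‖) * ((z - x)⁻¹ * ‖γ z - γ x‖) * (z - x)
      = (Metric.infDist (γ x) P + ‖γ x - γ z‖) * ‖γ x - γ z‖ := by
      rw [norm_sub_rev (γ z)]
      field_simp
    rw [h2]
    linarith

lemma path_bound {d : ℕ} (P : Set (Pt d)) (H : Pt d → ℝ)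
    (hH : ∀ z w, |H z - H w| ≤ (Metric.infDist z P + ‖z - w‖) * ‖z - w‖)
    (γ : ℝ → Pt d) (hγ : PiecewiseC1 γ) : H (γ 1) - H (γ 0) ≤ nnLength P γ := by
  obtain ⟨-, m, t, ht, h0, h1, hC⟩ := hγ
  let T : ℕ → ℝ := fun k => if h : k < m + 1 then t ⟨k, h⟩ else 1
  have hT : ∀ k < m, IntervalIntegrable (fun τ => Metric.infDist (γ τ) P * ‖deriv γ τ‖) volume
      (T k) (T (k + 1)) ∧ H (γ (T (k + 1))) - H (γ (T k)) ≤
        ∫ τ in (T k)..(T (k + 1)), Metric.infDist (γ τ) P * ‖deriv γ τ‖ := by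
    intro k hk
    have e1 : T k = t (Fin.castSucc ⟨k, hk⟩) := by
      simp only [T]; rw [dif_pos (by omega)]; rfl
    have e2 : T (k + 1) = t (Fin.succ ⟨k, hk⟩) := by
      simp only [T]; rw [dif_pos (by omega)]; rfl
    rw [e1, e2]
    exact piece_bound P H hH γ _ _ (ht (Fin.castSucc_lt_succ)) (hC _)
  have hT0 : T 0 = 0 := by
    simp only [T]; rw [dif_pos (by omega)]; exact h0
  have hTm : T m = 1 := by
    simp only [T]; rw [dif_pos (by omega)]; exact h1
  have hsum := intervalIntegral.sum_integral_adjacent_intervals (fun k hk => (hT k hk).1)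
  rw [hT0, hTm] at hsum
  rw [nnLength, ← hsum]
  have htel := Finset.sum_range_sub (fun k => H (γ (T k))) m
  simp only [hT0, hTm] at htel
  rw [← htel]
  exact Finset.sum_le_sum fun k hk => (hT k (Finset.mem_range.1 hk)).2

lemma edgeSq_bddBelow {d : ℕ} (P : Set (Pt d)) (a b : Pt d) :
    BddBelow {c : ℝ | ∃ (k : ℕ) (p : Fin (k + 1) → Pt d), p 0 = a ∧ p (Fin.last k) = b ∧
    (∀ i, p i ∈ P) ∧ c = ∑ i : Fin k, ‖p i.succ - p i.castSucc‖ ^ 2} := by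
  refine ⟨0, ?_⟩
  rintro c ⟨k, p, -, -, -, rfl⟩
  positivity

lemma edgeSq_nonempty {d : ℕ} (P : Set (Pt d)) (a b : Pt d) (ha : a ∈ P) (hb : b ∈ P) :
    {c : ℝ | ∃ (k : ℕ) (p : Fin (k + 1) → Pt d), p 0 = a ∧ p (Fin.last k) = b ∧
    (∀ i, p i ∈ P) ∧ c = ∑ i : Fin k, ‖p i.succ - p i.castSucc‖ ^ 2}.Nonempty := by
  refine ⟨_, 1, ![a, b], rfl, rfl, ?_, rfl⟩
  intro i
  fin_cases i <;> simp [ha, hb]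

lemma edgeSq_self {d : ℕ} (P : Set (Pt d)) (a : Pt d) (ha : a ∈ P) : edgeSq P a a ≤ 0 :=
  csInf_le (edgeSq_bddBelow P a a) ⟨0, fun _ => a, rfl, rfl, fun _ => ha, by simp⟩

lemma edgeSq_step {d : ℕ} (P : Set (Pt d)) (a x y : Pt d) (ha : a ∈ P) (hx : x ∈ P)
    (hy : y ∈ P) : edgeSq P a x - edgeSq P a y ≤ ‖x - y‖ ^ 2 := by
  rw [sub_le_comm]
  refine le_csInf (edgeSq_nonempty P a y ha hy) ?_
  rintro c ⟨k, p, h0, h1, hp, rfl⟩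
  rw [sub_le_iff_le_add]
  refine csInf_le (edgeSq_bddBelow P a x) ⟨k + 1, Fin.snoc (α := fun _ => Pt d) p x, ?_, ?_, ?_, ?_⟩
  · rw [← h0]; exact Fin.snoc_castSucc (α := fun _ => Pt d) x p 0
  · exact Fin.snoc_last (α := fun _ => Pt d) x p
  · intro i
    refine Fin.lastCases ?_ (fun j => ?_) i
    · rw [Fin.snoc_last]; exact hx
    · rw [Fin.snoc_castSucc]; exact hp j
  · rw [Fin.sum_univ_castSucc]
    simp only [Fin.succ_last, Fin.snoc_last, Fin.snoc_castSucc, Fin.succ_castSucc, h1]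

lemma nnLength_nonneg {d : ℕ} (P : Set (Pt d)) (γ : ℝ → Pt d) : 0 ≤ nnLength P γ :=
  intervalIntegral.integral_nonneg zero_le_one fun _ _ =>
    mul_nonneg Metric.infDist_nonneg (norm_nonneg _)

lemma seg_bound {d : ℕ} (P : Set (Pt d)) (p q : Pt d) (hp : p ∈ P) (hq : q ∈ P)
    (γ : ℝ → Pt d) (α β : ℝ) (hαβ : α < β)
    (hγ : ∀ t ∈ Set.Icc α β, γ t = p + ((t - α) / (β - α)) • (q - p)) :
    ContDiffOn ℝ 1 γ (Set.Icc α β) ∧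
    IntervalIntegrable (fun τ => Metric.infDist (γ τ) P * ‖deriv γ τ‖) volume α β ∧
    ∫ τ in α..β, Metric.infDist (γ τ) P * ‖deriv γ τ‖ ≤ ‖q - p‖ ^ 2 / 4 := by
  have hpos : 0 < β - α := sub_pos.2 hαβ
  set D := β - α with hD
  set L := ‖q - p‖ with hL
  let g : ℝ → Pt d := fun t => p + ((t - α) / D) • (q - p)
  have hg : ∀ t, HasDerivAt g ((1 / D) • (q - p)) t := fun t =>
    ((((hasDerivAt_id t).sub_const α).div_const D).smul_const (q - p)).const_add p
  have hgC : ContDiff ℝ 1 g := by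
    simp only [g]
    fun_prop
  have hder : ∀ t ∈ Set.Ioo α β, deriv γ t = (1 / D) • (q - p) := by
    intro t ht
    have : γ =ᶠ[nhds t] g := by
      filter_upwards [Icc_mem_nhds ht.1 ht.2] with x hx using hγ x hx
    rw [this.deriv_eq, (hg t).deriv]
  have hn : ‖(1 / D) • (q - p)‖ = L / D := by
    rw [norm_smul, Real.norm_of_nonneg (by positivity), ← hL]; ring
  have heq : Set.EqOn (fun τ => Metric.infDist (g τ) P * (L / D))
      (fun τ => Metric.infDist (γ τ) P * ‖deriv γ τ‖) (Set.Ioo α β) := by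
    intro τ hτ
    simp only [hder τ hτ, hn, hγ τ ⟨hτ.1.le, hτ.2.le⟩, g]
  have hc : Continuous (fun τ => Metric.infDist (g τ) P * (L / D)) :=
    ((Metric.continuous_infDist_pt P).comp hgC.continuous).mul continuous_const
  refine ⟨hgC.contDiffOn.congr hγ,
    (hc.intervalIntegrable α β).congr_uIoo (by rwa [Set.uIoo_of_le hαβ.le]), ?_⟩
  rw [← intervalIntegral.integral_congr_Ioo_of_le hαβ.le heq]
  set μ := (α + β) / 2 with hμ
  have hαμ : α ≤ μ := by linarith
  have hμβ : μ ≤ β := by linarith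
  have hL0 : 0 ≤ L := norm_nonneg _
  rw [← intervalIntegral.integral_add_adjacent_intervals (hc.intervalIntegrable α μ)
    (hc.intervalIntegrable μ β)]
  have I1 : ∫ τ in α..μ, Metric.infDist (g τ) P * (L / D) ≤ L ^ 2 / 8 := by
    have hb : ∫ τ in α..μ, Metric.infDist (g τ) P * (L / D)
        ≤ ∫ τ in α..μ, ((τ - α) / D * L) * (L / D) := by
      refine intervalIntegral.integral_mono_on hαμ (hc.intervalIntegrable _ _)
        (Continuous.intervalIntegrable (by fun_prop) _ _) fun τ hτ => ?_
      gcongr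
      refine (Metric.infDist_le_dist_of_mem hp).trans (le_of_eq ?_)
      have h0 : 0 ≤ (τ - α) / D := div_nonneg (by linarith [hτ.1]) hpos.le
      rw [dist_eq_norm]
      simp only [g]
      rw [add_sub_cancel_left, norm_smul, Real.norm_of_nonneg h0]
    refine hb.trans (le_of_eq ?_)
    have hd : ∀ τ ∈ Set.uIcc α μ, HasDerivAt (fun τ => (τ - α) ^ 2 * (L ^ 2 / (2 * D ^ 2)))
        (((τ - α) / D * L) * (L / D)) τ := by
      intro τ _
      refine ((((hasDerivAt_id τ).sub_const α).pow 2).mul_const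
        (L ^ 2 / (2 * D ^ 2))).congr_deriv ?_
      simp only [id]
      field_simp
      norm_num
      ring
    rw [intervalIntegral.integral_eq_sub_of_hasDerivAt hd
      (Continuous.intervalIntegrable (by fun_prop) _ _)]
    have : μ - α = D / 2 := by rw [hμ, hD]; ring
    rw [this]
    field_simp
    ring
  have I2 : ∫ τ in μ..β, Metric.infDist (g τ) P * (L / D) ≤ L ^ 2 / 8 := by
    have hb : ∫ τ in μ..β, Metric.infDist (g τ) P * (L / D)
        ≤ ∫ τ in μ..β, ((β - τ) / D * L) * (L / D) := by
      refine intervalIntegral.integral_mono_on hμβ (hc.intervalIntegrable _ _)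
        (Continuous.intervalIntegrable (by fun_prop) _ _) fun τ hτ => ?_
      gcongr
      refine (Metric.infDist_le_dist_of_mem hq).trans (le_of_eq ?_)
      have h0 : 0 ≤ (β - τ) / D := div_nonneg (by linarith [hτ.2]) hpos.le
      rw [dist_comm, dist_eq_norm]
      have h1 : q - g τ = ((β - τ) / D) • (q - p) := by
        have : (β - τ) / D = 1 - (τ - α) / D := by
          field_simp
          rw [hD]; ring
        simp only [g]
        rw [this]
        module
      rw [h1, norm_smul, Real.norm_of_nonneg h0]
    refine hb.trans (le_of_eq ?_)
    have hd : ∀ τ ∈ Set.uIcc μ β, HasDerivAt (fun τ => (β - τ) ^ 2 * (-L ^ 2 / (2 * D ^ 2)))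
        (((β - τ) / D * L) * (L / D)) τ := by
      intro τ _
      refine ((((hasDerivAt_id τ).const_sub β).pow 2).mul_const
        (-L ^ 2 / (2 * D ^ 2))).congr_deriv ?_
      simp only [id]
      field_simp
      norm_num
      ring
    rw [intervalIntegral.integral_eq_sub_of_hasDerivAt hd
      (Continuous.intervalIntegrable (by fun_prop) _ _)]
    have : β - μ = D / 2 := by rw [hμ, hD]; ring
    rw [this]
    field_simp
    ring
  linarith

lemma polygon {d : ℕ} (P : Set (Pt d)) (N : ℕ) (hN : 0 < N) (p : ℕ → Pt d) (hp : ∀ i, p i ∈ P) :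
    ∃ γ : ℝ → Pt d, PiecewiseC1 γ ∧ γ 0 = p 0 ∧ γ 1 = p N ∧
      nnLength P γ ≤ (∑ i ∈ Finset.range N, ‖p (i + 1) - p i‖ ^ 2) / 4 := by
  have hN' : (0 : ℝ) < N := by exact_mod_cast hN
  let γ : ℝ → Pt d := fun t =>
    p 0 + ∑ i ∈ Finset.range N, (max 0 (min 1 (N * t - i))) • (p (i + 1) - p i)
  have hc : Continuous γ := by
    simp only [γ]
    fun_prop
  have hlin : ∀ j < N, ∀ t ∈ Set.Icc ((j : ℝ) / N) (((j + 1 : ℕ) : ℝ) / N),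
      γ t = p j + ((N : ℝ) * t - j) • (p (j + 1) - p j) := by
    intro j hj t ht
    have h1 : (j : ℝ) ≤ N * t := by
      have := (div_le_iff₀ hN').1 ht.1; linarith
    have h2 : N * t ≤ j + 1 := by
      have := (le_div_iff₀ hN').1 ht.2
      push_cast at this
      linarith
    have key : ∀ n, j + 1 ≤ n → ∑ i ∈ Finset.range n,
        (max 0 (min 1 (N * t - i))) • (p (i + 1) - p i)
        = (p j - p 0) + ((N : ℝ) * t - j) • (p (j + 1) - p j) := by
      intro n hn
      induction n, hn using Nat.le_induction with
      | base =>
        rw [Finset.sum_range_succ, min_eq_right (by linarith), max_eq_right (by linarith),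
          ← Finset.sum_range_sub]
        congr 1
        refine Finset.sum_congr rfl fun i hi => ?_
        have hi : ((i + 1 : ℕ) : ℝ) ≤ j := by exact_mod_cast Finset.mem_range.1 hi
        push_cast at hi
        rw [min_eq_left (by linarith), max_eq_right (by linarith), one_smul]
      | succ n hn ih =>
        have hn' : ((j + 1 : ℕ) : ℝ) ≤ n := by exact_mod_cast hn
        push_cast at hn'
        rw [Finset.sum_range_succ, ih, min_eq_right (by linarith), max_eq_left (by linarith),
          zero_smul, add_zero]
    simp only [γ]
    rw [key N hj]
    abel
  have hseg : ∀ j < N, _ := fun j hj => seg_bound P (p j) (p (j + 1)) (hp _) (hp _) γ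
    ((j : ℝ) / N) (((j + 1 : ℕ) : ℝ) / N) (by gcongr; omega) (by
      intro t ht
      rw [hlin j hj t ht]
      congr 2
      push_cast
      field_simp
      ring)
  refine ⟨γ, ⟨hc.continuousOn, N, fun i => ((i : ℕ) : ℝ) / N, ?_, by simp, by simp [hN'.ne'], ?_⟩,
    ?_, ?_, ?_⟩
  · intro i j hij
    simp only
    have : (i : ℕ) < j := hij
    gcongr
  · intro i
    exact (hseg i i.2).1
  · rw [hlin 0 hN 0 ⟨by simp, by positivity⟩]; simp
  · obtain ⟨M, rfl⟩ : ∃ M, N = M + 1 := ⟨N - 1, by omega⟩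
    rw [hlin M (by omega) 1 ⟨by rw [div_le_one hN']; push_cast; linarith,
      by rw [div_self hN'.ne']⟩]
    push_cast
    rw [show ((M : ℝ) + 1) * 1 - M = 1 by ring, one_smul]
    abel
  · have hsum := intervalIntegral.sum_integral_adjacent_intervals
      (a := fun j : ℕ => (j : ℝ) / N) (fun k hk => (hseg k hk).2.1)
    simp only [Nat.cast_zero, zero_div, div_self hN'.ne'] at hsum
    rw [nnLength, ← hsum, Finset.sum_div]
    exact Finset.sum_le_sum fun k hk => (hseg k (Finset.mem_range.1 hk)).2.2

lemma chain_path {d : ℕ} (P : Set (Pt d)) (k : ℕ) (p : Fin (k + 1) → Pt d) (hp : ∀ i, p i ∈ P) :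
    ∃ γ : ℝ → Pt d, PiecewiseC1 γ ∧ γ 0 = p 0 ∧ γ 1 = p (Fin.last k) ∧
      nnLength P γ ≤ (∑ i : Fin k, ‖p i.succ - p i.castSucc‖ ^ 2) / 4 := by
  let q : ℕ → Pt d := fun i => p ⟨min i k, by omega⟩
  obtain ⟨γ, h1, h2, h3, h4⟩ := polygon P (k + 1) (by omega) q (fun i => hp _)
  refine ⟨γ, h1, ?_, ?_, h4.trans (le_of_eq ?_)⟩
  · rw [h2]; simp only [q]; congr 1
  · rw [h3]; simp only [q]; congr 1; apply Fin.ext; simp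
  · have hk : q (k + 1) = q k := by
      simp only [q]; congr 1; apply Fin.ext; simp
    rw [Finset.sum_range_succ, hk, sub_self, norm_zero,
      ← Fin.sum_univ_eq_sum_range (fun i => ‖q (i + 1) - q i‖ ^ 2) k]
    simp only [ne_eq, OfNat.ofNat_ne_zero, not_false_eq_true, zero_pow, add_zero]
    congr 1
    refine Finset.sum_congr rfl fun i _ => ?_
    have e1 : q (i + 1) = p i.succ := by
      simp only [q]; congr 1; apply Fin.ext; simp
    have e2 : q i = p i.castSucc := by
      simp only [q]; congr 1; apply Fin.ext; simp
    rw [e1, e2]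


/-- For any finite point set `P ⊆ ℝ^d`, the edge-squared metric and the
nearest-neighbor geodesic distance are identical on `P`. -/
theorem edgeSq_eq_nnGeo (d : ℕ) (P : Set (Pt d)) (hP : P.Finite)
    (a b : Pt d) (ha : a ∈ P) (hb : b ∈ P) :
    edgeSq P a b = nnGeo P a b := by
  have hbdd : BddBelow {l : ℝ | ∃ γ : ℝ → Pt d,
      PiecewiseC1 γ ∧ γ 0 = a ∧ γ 1 = b ∧ l = nnLength P γ} := by
    refine ⟨0, ?_⟩
    rintro l ⟨γ, -, -, -, rfl⟩
    exact nnLength_nonneg P γ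
  apply le_antisymm
  · have hne : {l : ℝ | ∃ γ : ℝ → Pt d,
        PiecewiseC1 γ ∧ γ 0 = a ∧ γ 1 = b ∧ l = nnLength P γ}.Nonempty := by
      obtain ⟨_, k, p, h0, h1, hp, -⟩ := edgeSq_nonempty P a b ha hb
      obtain ⟨γ, g1, g2, g3, -⟩ := chain_path P k p hp
      exact ⟨_, γ, g1, g2.trans h0, g3.trans h1, rfl⟩
    obtain ⟨H, hH1, hH2⟩ := potential P hP (edgeSq P a)
      (fun x hx y hy => edgeSq_step P a x y ha hx hy) a b ha hb
    have hle : edgeSq P a b / 4 ≤ sInf {l : ℝ | ∃ γ : ℝ → Pt d,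
        PiecewiseC1 γ ∧ γ 0 = a ∧ γ 1 = b ∧ l = nnLength P γ} := by
      refine le_csInf hne ?_
      rintro l ⟨γ, g1, g2, g3, rfl⟩
      have h1 := path_bound P H hH2 γ g1
      rw [g2, g3] at h1
      have h2 := edgeSq_self P a ha
      linarith
    unfold nnGeo
    linarith
  · refine le_csInf (edgeSq_nonempty P a b ha hb) ?_
    rintro c ⟨k, p, h0, h1, hp, rfl⟩
    obtain ⟨γ, g1, g2, g3, g4⟩ := chain_path P k p hp
    have h2 := csInf_le hbdd ⟨γ, g1, g2.trans h0, g3.trans h1, rfl⟩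
    unfold nnGeo
    linarith
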